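/- There exists a squarefree infinite word (w_n)_{n≥0} over the alphabet {0,1,2} such that for every integer k ≥ 3 the subsequence (w_{kn})_{n≥0} contains a square, i.e., there exist n ≥ 0 and L ≥ 1 with w_{k(n+j)} = w_{k(n+L+j)} for all 0 ≤ j < L. (This answers Harju's first problem in the affirmative; the word vtm is such a word.) -/

import Mathlib

/-- The Thue-Morse sequence. -/
def tm (n : ℕ) : Bool := (Nat.digits 2 n).sum % 2 == 1

theorem tm_even (n : ℕ) : tm (2 * n) = tm n := by
  rcases Nat.eq_zero_or_pos n with h | h
  · subst h; rfl
  · unfold tm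
    rw [Nat.digits_def' (by norm_num) (by omega)]
    simp

theorem tm_odd (n : ℕ) : tm (2 * n + 1) = !tm n := by
  unfold tm
  rw [Nat.digits_def' (by norm_num) (by omega)]
  have h1 : (2 * n + 1) % 2 = 1 := by omega
  have h2 : (2 * n + 1) / 2 = n := by omega
  rw [h1, h2, List.sum_cons]
  rcases Nat.mod_two_eq_zero_or_one (Nat.digits 2 n).sum with h | h
  · have : (1 + (Nat.digits 2 n).sum) % 2 = 1 := by omega
    simp [h, this]
  · have : (1 + (Nat.digits 2 n).sum) % 2 = 0 := by omega
    simp [h, this]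

theorem tm_split (a : ℕ) : ∀ H l : ℕ, l < 2 ^ a → tm (2 ^ a * H + l) = xor (tm H) (tm l) := by
  induction a with
  | zero =>
    intro H l hl
    have : l = 0 := by simpa using hl
    subst this
    simp [tm]
  | succ a ih =>
    intro H l hl
    have hp : 2 ^ (a + 1) = 2 * 2 ^ a := by ring
    rw [hp] at hl ⊢
    rcases Nat.even_or_odd' l with ⟨m, rfl | rfl⟩
    · have e : 2 * 2 ^ a * H + 2 * m = 2 * (2 ^ a * H + m) := by ring
      rw [e, tm_even, tm_even, ih H m (by omega)]
    · have e : 2 * 2 ^ a * H + (2 * m + 1) = 2 * (2 ^ a * H + m) + 1 := by ring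
      rw [e, tm_odd, tm_odd, ih H m (by omega)]
      cases tm H <;> cases tm m <;> rfl

/-- Thue-Morse is overlap-free. -/
theorem tm_overlap_free (L : ℕ) : 1 ≤ L → ∀ i, (∀ j ≤ L, tm (i + j) = tm (i + L + j)) → False := by
  induction L using Nat.strong_induction_on with
  | _ L ih =>
    intro hL i h
    rcases Nat.even_or_odd' L with ⟨M, hM | hM⟩
    · rcases Nat.even_or_odd' i with ⟨p, hp | hp⟩
      · refine ih M (by omega) (by omega) p fun j hj => ?_
        have := h (2 * j) (by omega)
        rw [show i + 2 * j = 2 * (p + j) by omega,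
          show i + L + 2 * j = 2 * (p + M + j) by omega, tm_even, tm_even] at this
        exact this
      · refine ih M (by omega) (by omega) p fun j hj => ?_
        have := h (2 * j) (by omega)
        rw [show i + 2 * j = 2 * (p + j) + 1 by omega,
          show i + L + 2 * j = 2 * (p + M + j) + 1 by omega, tm_odd, tm_odd] at this
        simpa using this
    · have alt : ∀ j < L, tm (i + (j + 1)) = !tm (i + j) := by
        intro j hj
        rcases Nat.even_or_odd' (i + j) with ⟨p, hp | hp⟩
        · rw [show i + (j + 1) = 2 * p + 1 by omega, hp, tm_odd, tm_even]
        · rw [h (j + 1) (by omega), h j (by omega),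
            show i + L + (j + 1) = 2 * (p + M + 1) + 1 by omega,
            show i + L + j = 2 * (p + M + 1) by omega, tm_odd, tm_even]
      have alt2 : ∀ j, 2 * j ≤ L → tm (i + 2 * j) = tm i := by
        intro j
        induction j with
        | zero => intro _; rfl
        | succ j ihj =>
          intro hj
          have h1 := alt (2 * j) (by omega)
          have h2 := alt (2 * j + 1) (by omega)
          rw [show i + 2 * (j + 1) = i + (2 * j + 1 + 1) by ring, h2, h1, ihj (by omega)]
          simp
      have h1 := alt (2 * M) (by omega)
      rw [alt2 M (by omega)] at h1
      have h0 := h 0 (by omega)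
      rw [show i + L + 0 = i + (2 * M + 1) by omega, h1] at h0
      simp at h0

/-- The ternary Thue-Morse word vtm. -/
def vtm (n : ℕ) : Fin 3 := if tm n = tm (n + 1) then 1 else if tm n then 0 else 2

def tmZ (n : ℕ) : ℤ := if tm n then 1 else 0

theorem vtm_diff {m n : ℕ} (h : vtm m = vtm n) :
    tmZ (m + 1) - tmZ m = tmZ (n + 1) - tmZ n := by
  unfold vtm at h
  unfold tmZ
  revert h
  cases tm m <;> cases tm (m + 1) <;> cases tm n <;> cases tm (n + 1) <;> decide

theorem tmZ_inj {m n : ℕ} (h : tmZ m = tmZ n) : tm m = tm n := by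
  unfold tmZ at h
  revert h
  cases tm m <;> cases tm n <;> decide

theorem tmZ_range (m : ℕ) : tmZ m = 0 ∨ tmZ m = 1 := by
  unfold tmZ
  cases tm m <;> simp

theorem vtm_squarefree (i L : ℕ) (hL : 1 ≤ L) (h : ∀ j < L, vtm (i + j) = vtm (i + L + j)) :
    False := by
  have key : ∀ j ≤ L, tmZ (i + j) - tmZ i = tmZ (i + L + j) - tmZ (i + L) := by
    intro j
    induction j with
    | zero => intro _; simp
    | succ j ihj =>
      intro hj
      have h1 := vtm_diff (h j (by omega))
      have h2 := ihj (by omega)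
      rw [← add_assoc, ← add_assoc]
      linarith
  have hend := key L le_rfl
  have hi : tmZ i = tmZ (i + L) := by
    rcases tmZ_range i with a | a <;> rcases tmZ_range (i + L) with b | b <;>
      rcases tmZ_range (i + L + L) with c | c <;> omega
  refine tm_overlap_free L hL i fun j hj => tmZ_inj ?_
  have := key j hj
  omega

theorem tm_dist (i : ℕ) : (∃ r, tm r = tm (r + i)) ∧ (1 ≤ i → ∃ r, tm r = !tm (r + i)) := by
  induction i using Nat.strong_induction_on with
  | _ i ih =>
    rcases Nat.even_or_odd' i with ⟨j, hj | hj⟩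
    · refine ⟨?_, fun hi => ?_⟩
      · rcases Nat.eq_zero_or_pos i with h0 | h0
        · exact ⟨0, by rw [h0]⟩
        · obtain ⟨r, hr⟩ := (ih j (by omega)).1
          exact ⟨2 * r, by rw [show 2 * r + i = 2 * (r + j) by omega, tm_even, tm_even, hr]⟩
      · obtain ⟨r, hr⟩ := (ih j (by omega)).2 (by omega)
        exact ⟨2 * r, by rw [show 2 * r + i = 2 * (r + j) by omega, tm_even, tm_even, hr]⟩
    · refine ⟨?_, fun hi => ?_⟩
      · rcases Nat.eq_zero_or_pos j with h0 | h0
        · refine ⟨1, ?_⟩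
          rw [show 1 + i = 2 * 1 by omega, tm_even]
        · obtain ⟨r, hr⟩ := (ih j (by omega)).2 (by omega)
          exact ⟨2 * r, by rw [show 2 * r + i = 2 * (r + j) + 1 by omega, tm_even, tm_odd, hr]⟩
      · obtain ⟨r, hr⟩ := (ih j (by omega)).1
        exact ⟨2 * r, by
          rw [show 2 * r + i = 2 * (r + j) + 1 by omega, tm_even, tm_odd, hr, Bool.not_not]⟩

theorem vtm_even (p : ℕ) : vtm (2 * p) = if tm p then 0 else 2 := by
  unfold vtm
  rw [tm_even, tm_odd]
  cases tm p <;> rfl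

theorem vtm_mod8 (r : ℕ) : vtm (8 * r + 3) = if tm r then 0 else 2 := by
  unfold vtm
  rw [show 8 * r + 3 = 2 * (2 * (2 * (2 * r)) / 2 + 1) + 1 by omega,
    show 2 * (2 * (2 * (2 * r)) / 2 + 1) + 1 + 1 = 2 * (2 * (2 * r + 1)) by omega,
    show 2 * (2 * (2 * r)) / 2 + 1 = 2 * (2 * r) + 1 by omega]
  simp only [tm_even, tm_odd]
  cases tm r <;> rfl

/-- For odd `k ≥ 3` some letter of vtm recurs at distance `k`. -/
theorem vtm_dist (k : ℕ) (hk : 3 ≤ k) (ho : k % 2 = 1) : ∃ l, vtm l = vtm (l + k) := by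
  suffices H : ∃ p r, 2 * p + k = 8 * r + 3 ∧ tm p = tm r by
    obtain ⟨p, r, h1, h2⟩ := H
    exact ⟨2 * p, by rw [h1, vtm_even, vtm_mod8, h2]⟩
  obtain ⟨i, d, hd, hs⟩ : ∃ i d, d < 4 ∧ k = 3 + 2 * (4 * i + d) :=
    ⟨(k - 3) / 8, (k - 3) / 2 % 4, by omega, by omega⟩
  interval_cases d
  · obtain ⟨r, hr⟩ := (tm_dist i).1
    refine ⟨4 * r, r + i, by omega, ?_⟩
    rw [show 4 * r = 2 * (2 * r) by ring, tm_even, tm_even, hr]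
  · obtain ⟨r, hr⟩ := (tm_dist (i + 1)).1
    refine ⟨4 * r + 3, r + (i + 1), by omega, ?_⟩
    rw [show 4 * r + 3 = 2 * (2 * r + 1) + 1 by ring, tm_odd, tm_odd, hr, Bool.not_not]
  · obtain ⟨r, hr⟩ := (tm_dist (i + 1)).2 (by omega)
    refine ⟨4 * r + 2, r + (i + 1), by omega, ?_⟩
    rw [show 4 * r + 2 = 2 * (2 * r + 1) by ring, tm_even, tm_odd, hr, Bool.not_not]
  · obtain ⟨r, hr⟩ := (tm_dist (i + 1)).2 (by omega)
    refine ⟨4 * r + 1, r + (i + 1), by omega, ?_⟩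
    rw [show 4 * r + 1 = 2 * (2 * r) + 1 by ring, tm_odd, tm_even, hr, Bool.not_not]

theorem vtm_lift (a H l m : ℕ) (hl : l + 1 < 2 ^ a) (hm : m + 1 < 2 ^ a) (h : vtm l = vtm m) :
    vtm (2 ^ a * H + l) = vtm (2 ^ a * H + m) := by
  unfold vtm at h ⊢
  rw [add_assoc, add_assoc, tm_split a H l (by omega), tm_split a H m (by omega),
    tm_split a H _ hl, tm_split a H _ hm]
  revert h
  cases tm H <;> cases tm l <;> cases tm (l + 1) <;> cases tm m <;> cases tm (m + 1) <;> decide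

theorem vtm_odd_square (k : ℕ) (hk : 3 ≤ k) (ho : k % 2 = 1) :
    ∃ n, vtm (k * n) = vtm (k * (n + 1)) := by
  obtain ⟨l, hl⟩ := vtm_dist k hk ho
  have hlt : l + k + 1 < 2 ^ (l + k + 1) := Nat.lt_two_pow_self
  obtain ⟨a, ha⟩ : ∃ a, a = l + k + 1 := ⟨_, rfl⟩
  rw [← ha] at hlt
  have hco : Nat.Coprime k (2 ^ a) :=
    Nat.Coprime.pow_right _ (Nat.coprime_two_right.2 (Nat.odd_iff.2 ho))
  obtain ⟨N, hN1, hN2⟩ := Nat.chineseRemainder hco 0 l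
  obtain ⟨n, rfl⟩ := (Nat.modEq_zero_iff_dvd).1 hN1
  have hmod : k * n % 2 ^ a = l := by
    rw [hN2, Nat.mod_eq_of_lt (by omega)]
  have hdiv := Nat.div_add_mod (k * n) (2 ^ a)
  rw [hmod] at hdiv
  refine ⟨n, ?_⟩
  rw [mul_add, mul_one, ← hdiv, add_assoc]
  exact vtm_lift a _ l (l + k) (by omega) (by omega) hl

theorem vtm_even_square (m : ℕ) :
    ∃ (n L : ℕ), 1 ≤ L ∧ ∀ j < L, vtm (2 * m * (n + j)) = vtm (2 * m * (n + L + j)) := by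
  have hv : ∀ x, vtm (2 * m * x) = if tm (m * x) then 0 else 2 := by
    intro x; rw [mul_assoc, vtm_even]
  simp only [hv]
  by_cases h01 : tm (m * 0) = tm (m * 1)
  · exact ⟨0, 1, le_rfl, fun j hj => by interval_cases j; simp only [Nat.add_zero, Nat.zero_add, h01]⟩
  by_cases h12 : tm (m * 1) = tm (m * 2)
  · exact ⟨1, 1, le_rfl, fun j hj => by
      interval_cases j; simp only [Nat.add_zero, Nat.reduceAdd, h12]⟩
  by_cases h23 : tm (m * 2) = tm (m * 3)
  · exact ⟨2, 1, le_rfl, fun j hj => by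
      interval_cases j; simp only [Nat.add_zero, Nat.reduceAdd, h23]⟩
  have h02 : tm (m * 0) = tm (m * 2) := by
    revert h01 h12; cases tm (m * 0) <;> cases tm (m * 1) <;> cases tm (m * 2) <;> decide
  have h13 : tm (m * 1) = tm (m * 3) := by
    revert h12 h23; cases tm (m * 3) <;> cases tm (m * 1) <;> cases tm (m * 2) <;> decide
  refine ⟨0, 2, by norm_num, fun j hj => ?_⟩
  interval_cases j
  · simp only [Nat.add_zero, Nat.zero_add, h02]
  · simp only [Nat.zero_add, Nat.reduceAdd, h13]

/-- There is a squarefree infinite ternary word w such that for every k ≥ 3 the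
subsequence (w_{kn}) contains a square. -/
theorem exists_squarefree_word_all_subseq_square :
    ∃ w : ℕ → Fin 3,
      (¬ ∃ (i L : ℕ), 1 ≤ L ∧ ∀ j < L, w (i + j) = w (i + L + j)) ∧
      ∀ k : ℕ, 3 ≤ k →
        ∃ (n L : ℕ), 1 ≤ L ∧ ∀ j < L, w (k * (n + j)) = w (k * (n + L + j)) := by
  refine ⟨vtm, ?_, fun k hk => ?_⟩
  · rintro ⟨i, L, hL, h⟩
    exact vtm_squarefree i L hL h
  · rcases Nat.even_or_odd' k with ⟨m, hm | hm⟩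
    · rw [hm]
      exact vtm_even_square m
    · obtain ⟨n, hn⟩ := vtm_odd_square k hk (by omega)
      exact ⟨n, 1, le_rfl, fun j hj => by interval_cases j; simpa using hn⟩
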